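/- Let X and Y be real Banach spaces. If X has the Ball Dentable Property and Y has the Ball Small Combination of Slices Property, then the projective tensor product X ⊗̂_π Y has the Ball Small Combination of Slices Property. -/

import Mathlib

set_option synthInstance.maxHeartbeats 1000000
set_option maxHeartbeats 1000000

open Metric Set Filter

noncomputable section

/-- A Banach space `Z` has the **Ball Dentable Property** (`BDP`) if its closed unit ball
has slices of arbitrarily small diameter. -/
def BallDentableProperty (Z : Type*) [NormedAddCommGroup Z] [NormedSpace ℝ Z] : Prop :=
  ∀ ε : ℝ, 0 < ε → ∃ (f : StrongDual ℝ Z) (α : ℝ), ‖f‖ = 1 ∧ 0 < α ∧ α < 1 ∧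
    Metric.diam {z : Z | ‖z‖ ≤ 1 ∧ 1 - α < f z} < ε

/-- The dual `Z*` of a Banach space `Z` has the **w*-Ball Dentable Property** (`w*-BDP`) if the
closed unit ball of `Z*` has weak-star slices (slices given by elements of the predual `Z`)
of arbitrarily small diameter. -/
def WStarBallDentableProperty (Z : Type*) [NormedAddCommGroup Z] [NormedSpace ℝ Z] : Prop :=
  ∀ ε : ℝ, 0 < ε → ∃ (z : Z) (α : ℝ), ‖z‖ = 1 ∧ 0 < α ∧ α < 1 ∧
    Metric.diam {f : StrongDual ℝ Z | ‖f‖ ≤ 1 ∧ 1 - α < f z} < ε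

/-- A Banach space `Z` has the **Ball Small Combination of Slices Property** (`BSCSP`) if its
closed unit ball has convex combinations of slices of arbitrarily small diameter. -/
def BallSCSProperty (Z : Type*) [NormedAddCommGroup Z] [NormedSpace ℝ Z] : Prop :=
  ∀ ε : ℝ, 0 < ε → ∃ (n : ℕ) (lam : Fin (n + 1) → ℝ) (f : Fin (n + 1) → StrongDual ℝ Z)
    (α : Fin (n + 1) → ℝ),
    (∀ i, 0 < lam i) ∧ (∑ i, lam i = 1) ∧ (∀ i, ‖f i‖ = 1) ∧ (∀ i, 0 < α i ∧ α i < 1) ∧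
    Metric.diam {z : Z | ∃ g : Fin (n + 1) → Z,
      (∀ i, ‖g i‖ ≤ 1 ∧ 1 - α i < f i (g i)) ∧ z = ∑ i, lam i • g i} < ε

/-- The dual `Z*` of a Banach space `Z` has the **w*-Ball Small Combination of Slices Property**
(`w*-BSCSP`) if the closed unit ball of `Z*` has convex combinations of weak-star slices
(slices given by elements of the predual `Z`) of arbitrarily small diameter. -/
def WStarBallSCSProperty (Z : Type*) [NormedAddCommGroup Z] [NormedSpace ℝ Z] : Prop :=
  ∀ ε : ℝ, 0 < ε → ∃ (n : ℕ) (lam : Fin (n + 1) → ℝ) (z : Fin (n + 1) → Z)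
    (α : Fin (n + 1) → ℝ),
    (∀ i, 0 < lam i) ∧ (∑ i, lam i = 1) ∧ (∀ i, ‖z i‖ = 1) ∧ (∀ i, 0 < α i ∧ α i < 1) ∧
    Metric.diam {φ : StrongDual ℝ Z | ∃ g : Fin (n + 1) → StrongDual ℝ Z,
      (∀ i, ‖g i‖ ≤ 1 ∧ 1 - α i < g i (z i)) ∧ φ = ∑ i, lam i • g i} < ε

/-- The roughness `η(Z, u)` of the norm of `Z` at `u`:
`limsup_{‖h‖ → 0} (‖u + h‖ + ‖u - h‖ - 2) / ‖h‖`. -/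
noncomputable def roughness (Z : Type*) [NormedAddCommGroup Z] (u : Z) : ℝ :=
  Filter.limsup (fun h : Z => (‖u + h‖ + ‖u - h‖ - 2) / ‖h‖) (nhdsWithin 0 {(0 : Z)}ᶜ)

/-- The norm of `Z` is **rough** if it is `ε`-rough for some `ε > 0`, i.e. there is `ε > 0`
with `η(Z, u) ≥ ε` for every `u` in the unit sphere of `Z`. -/
def RoughNorm (Z : Type*) [NormedAddCommGroup Z] : Prop :=
  ∃ ε : ℝ, 0 < ε ∧ ∀ u : Z, ‖u‖ = 1 → ε ≤ roughness Z u

/-- The norm of `Z` is **non-rough** if it is not rough. -/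
def NonRoughNorm (Z : Type*) [NormedAddCommGroup Z] : Prop := ¬ RoughNorm Z

/-- The rank-one operator `x* ⊗ y : E → F`, `x ↦ x*(x) • y`. -/
noncomputable def rankOneOp {E F : Type*} [NormedAddCommGroup E] [NormedSpace ℝ E]
    [NormedAddCommGroup F] [NormedSpace ℝ F] (f : StrongDual ℝ E) (y : F) : E →L[ℝ] F :=
  f.smulRight y

/-- For a subspace `H ⊆ L(E, F)`, a vector `x ∈ E` and a functional `g ∈ F*`, the functional
`x ⊗ g ∈ H*` given by `T ↦ g (T x)`. -/
noncomputable def dualTensorFunctional {E F : Type*} [NormedAddCommGroup E] [NormedSpace ℝ E]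
    [NormedAddCommGroup F] [NormedSpace ℝ F] (H : Submodule ℝ (E →L[ℝ] F)) (x : E)
    (g : StrongDual ℝ F) : StrongDual ℝ H :=
  g.comp ((ContinuousLinearMap.apply ℝ F x).comp H.subtypeL)

/-- The weak-star closed convex hull of a subset `S` of the dual `Z*`. -/
noncomputable def wStarClosedConvexHull (Z : Type*) [NormedAddCommGroup Z] [NormedSpace ℝ Z]
    (S : Set (StrongDual ℝ Z)) : Set (StrongDual ℝ Z) :=
  StrongDual.toWeakDual ⁻¹'
    closure (convexHull ℝ (StrongDual.toWeakDual '' S))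

/-- `D(Z, u)`: the set of norm-at-most-one functionals attaining the value `1` at `u`. -/
def dualFace (Z : Type*) [NormedAddCommGroup Z] [NormedSpace ℝ Z] (u : Z) :
    Set (StrongDual ℝ Z) := {h | ‖h‖ ≤ 1 ∧ h u = 1}

/-- `n(Z, u)`: the largest non-negative `k` such that
`k * ‖z‖ ≤ sup {|f z| : f ∈ D(Z, u)}` for every `z ∈ Z`. -/
noncomputable def nConstant (Z : Type*) [NormedAddCommGroup Z] [NormedSpace ℝ Z] (u : Z) : ℝ :=
  sSup {k : ℝ | 0 ≤ k ∧ ∀ z : Z, k * ‖z‖ ≤ ⨆ f : dualFace Z u, |f.1 z|}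

/-- The Banach space `B(X × Y)` of bounded bilinear forms on `X × Y`, realized as
`X →L[ℝ] Y →L[ℝ] ℝ`. -/
def BoundedBilinearForms (X Y : Type*) [NormedAddCommGroup X] [NormedSpace ℝ X]
    [NormedAddCommGroup Y] [NormedSpace ℝ Y] : Type _ :=
  X →L[ℝ] Y →L[ℝ] ℝ

noncomputable instance {X Y : Type*} [NormedAddCommGroup X] [NormedSpace ℝ X]
    [NormedAddCommGroup Y] [NormedSpace ℝ Y] : NormedAddCommGroup (BoundedBilinearForms X Y) :=
  inferInstanceAs (NormedAddCommGroup (X →L[ℝ] Y →L[ℝ] ℝ))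

noncomputable instance {X Y : Type*} [NormedAddCommGroup X] [NormedSpace ℝ X]
    [NormedAddCommGroup Y] [NormedSpace ℝ Y] : NormedSpace ℝ (BoundedBilinearForms X Y) :=
  inferInstanceAs (NormedSpace ℝ (X →L[ℝ] Y →L[ℝ] ℝ))

/-- The canonical image of the elementary tensor `x ⊗ y` in the dual of the space of bounded
bilinear forms on `X × Y`; it acts by `B ↦ B x y`. -/
noncomputable def projTensorElem {X Y : Type*} [NormedAddCommGroup X] [NormedSpace ℝ X]
    [NormedAddCommGroup Y] [NormedSpace ℝ Y] (x : X) (y : Y) :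
    StrongDual ℝ (BoundedBilinearForms X Y) :=
  (ContinuousLinearMap.apply ℝ ℝ y).comp (ContinuousLinearMap.apply ℝ (Y →L[ℝ] ℝ) x)

/-- The projective tensor product `X ⊗̂_π Y`, realized canonically (and isometrically) as the
closure of the span of the elementary tensors inside the dual of the Banach space of bounded
bilinear forms on `X × Y`.  (On elementary tensor combinations the dual norm coincides with the
projective norm, so this closed subspace is the canonical isometric copy of the completion
`X ⊗̂_π Y`.) -/
noncomputable def ProjectiveTensorProduct (X Y : Type*) [NormedAddCommGroup X] [NormedSpace ℝ X]
    [NormedAddCommGroup Y] [NormedSpace ℝ Y] :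
    Submodule ℝ (StrongDual ℝ (BoundedBilinearForms X Y)) :=
  (Submodule.span ℝ {φ | ∃ x y, φ = projTensorElem x y}).topologicalClosure

/-- The projective tensor product `X ⊗̂_π Y` as a Banach space. -/
def ProjectiveTensorSpace (X Y : Type*) [NormedAddCommGroup X] [NormedSpace ℝ X]
    [NormedAddCommGroup Y] [NormedSpace ℝ Y] : Type _ :=
  ↥(ProjectiveTensorProduct X Y)

noncomputable instance {X Y : Type*} [NormedAddCommGroup X] [NormedSpace ℝ X]
    [NormedAddCommGroup Y] [NormedSpace ℝ Y] : NormedAddCommGroup (ProjectiveTensorSpace X Y) :=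
  inferInstanceAs (NormedAddCommGroup ↥(ProjectiveTensorProduct X Y))

noncomputable instance {X Y : Type*} [NormedAddCommGroup X] [NormedSpace ℝ X]
    [NormedAddCommGroup Y] [NormedSpace ℝ Y] : NormedSpace ℝ (ProjectiveTensorSpace X Y) :=
  inferInstanceAs (NormedSpace ℝ ↥(ProjectiveTensorProduct X Y))

/-- The rank-one operator `x ⊗ y : X* → Y`, `x* ↦ x*(x) • y`. -/
noncomputable def injTensorElem {X Y : Type*} [NormedAddCommGroup X] [NormedSpace ℝ X]
    [NormedAddCommGroup Y] [NormedSpace ℝ Y] (x : X) (y : Y) :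
    StrongDual ℝ X →L[ℝ] Y :=
  (ContinuousLinearMap.apply ℝ ℝ x).smulRight y

set_option maxSynthPendingDepth 3

/-- The injective tensor product `X ⊗̂_ε Y`, realized canonically (and isometrically) as the
closure of the span of the rank-one operators `x ⊗ y` inside the Banach space `L(X*, Y)`.
(On elementary tensor combinations the operator norm coincides with the injective norm, so this
closed subspace is the canonical isometric copy of the completion `X ⊗̂_ε Y`.) -/
noncomputable def InjectiveTensorProduct (X Y : Type*) [NormedAddCommGroup X] [NormedSpace ℝ X]
    [NormedAddCommGroup Y] [NormedSpace ℝ Y] :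
    Submodule ℝ (StrongDual ℝ X →L[ℝ] Y) :=
  (Submodule.span ℝ {T | ∃ x y, T = injTensorElem x y}).topologicalClosure

/-- The injective tensor product `X ⊗̂_ε Y` as a Banach space. -/
def InjectiveTensorSpace (X Y : Type*) [NormedAddCommGroup X] [NormedSpace ℝ X]
    [NormedAddCommGroup Y] [NormedSpace ℝ Y] : Type _ :=
  ↥(InjectiveTensorProduct X Y)

noncomputable instance {X Y : Type*} [NormedAddCommGroup X] [NormedSpace ℝ X]
    [NormedAddCommGroup Y] [NormedSpace ℝ Y] : NormedAddCommGroup (InjectiveTensorSpace X Y) :=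
  inferInstanceAs (NormedAddCommGroup ↥(InjectiveTensorProduct X Y))

noncomputable instance {X Y : Type*} [NormedAddCommGroup X] [NormedSpace ℝ X]
    [NormedAddCommGroup Y] [NormedSpace ℝ Y] : NormedSpace ℝ (InjectiveTensorSpace X Y) :=
  inferInstanceAs (NormedSpace ℝ ↥(InjectiveTensorProduct X Y))

end


theorem exists_slice_point {Z : Type*} [NormedAddCommGroup Z] [NormedSpace ℝ Z]
    (f : StrongDual ℝ Z) (hf : ‖f‖ = 1) (α : ℝ) (hα : 0 < α) :
    ∃ z : Z, ‖z‖ ≤ 1 ∧ 1 - α < f z := by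
  obtain ⟨z, hz, h⟩ := f.exists_lt_apply_of_lt_opNorm (r := 1 - α) (by linarith)
  rw [Real.norm_eq_abs] at h
  rcases lt_abs.1 h with h | h
  · exact ⟨z, hz.le, h⟩
  · exact ⟨-z, by rw [norm_neg]; exact hz.le, by rw [map_neg]; exact h⟩

theorem apply_le_one_of {Z : Type*} [NormedAddCommGroup Z] [NormedSpace ℝ Z]
    (f : StrongDual ℝ Z) (hf : ‖f‖ = 1) (z : Z) (hz : ‖z‖ ≤ 1) : |f z| ≤ 1 := by
  have := f.le_opNorm z
  rw [hf, one_mul, Real.norm_eq_abs] at this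
  exact this.trans hz

/-- Elementary tensors with large value may be represented with both factors in the slices. -/
theorem sign_fix (a b δ : ℝ) (ha : |a| ≤ 1) (hb : |b| ≤ 1) (hδ : δ ≤ 1) (h : 1 - δ < a * b) :
    (1 - δ < a ∧ 1 - δ < b) ∨ (1 - δ < -a ∧ 1 - δ < -b) := by
  rw [abs_le] at ha hb
  have hpos : 0 < a * b := by linarith
  rcases pos_and_pos_or_neg_and_neg_of_mul_pos hpos with ⟨h1, h2⟩ | ⟨h1, h2⟩
  · left; constructor <;> nlinarith
  · right; constructor <;> nlinarith

theorem key_approx {X Y P : Type*} [NormedAddCommGroup X] [NormedSpace ℝ X]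
    [NormedAddCommGroup Y] [NormedSpace ℝ Y] [NormedAddCommGroup P] [NormedSpace ℝ P]
    (T : X →ₗ[ℝ] Y →ₗ[ℝ] P) (hT : ∀ x y, ‖T x y‖ ≤ ‖x‖ * ‖y‖)
    (hball : ∀ z : P, ‖z‖ ≤ 1 →
      z ∈ closure (convexHull ℝ {w | ∃ x y, ‖x‖ ≤ 1 ∧ ‖y‖ ≤ 1 ∧ w = T x y}))
    (f : StrongDual ℝ X) (g : StrongDual ℝ Y) (hf : ‖f‖ = 1) (hg : ‖g‖ = 1)
    (φ : StrongDual ℝ P) (hφ : ∀ x y, φ (T x y) = f x * g y)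
    (α β δ e : ℝ) (hβ : 0 < β) (hδ : 0 < δ) (hδ1 : δ ≤ 1) (hδα : δ ≤ α)
    (hδβ : δ ≤ β) (he : 0 < e) (x0 : X) (hx0 : ‖x0‖ ≤ 1)
    (hd : ∀ x, ‖x‖ ≤ 1 → 1 - α < f x → ‖x - x0‖ ≤ e)
    (z : P) (hz : ‖z‖ ≤ 1) (hφz : 1 - δ * e / 2 < φ z) :
    ∃ y, (‖y‖ ≤ 1 ∧ 1 - β < g y) ∧ ‖z - T x0 y‖ ≤ 3 * e := by
  set D : Set P := {w | ∃ y, (‖y‖ ≤ 1 ∧ 1 - β < g y) ∧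
    ‖w - T x0 y‖ ≤ e + 2 / δ * (1 - φ w)} with hD
  have hconv : Convex ℝ D := by
    rintro w ⟨y, ⟨hy1, hy2⟩, hy3⟩ w' ⟨y', ⟨hy1', hy2'⟩, hy3'⟩ a b ha hb hab
    refine ⟨a • y + b • y', ⟨?_, ?_⟩, ?_⟩
    · calc ‖a • y + b • y'‖ ≤ ‖a • y‖ + ‖b • y'‖ := norm_add_le _ _
        _ = a * ‖y‖ + b * ‖y'‖ := by
          rw [norm_smul, norm_smul, Real.norm_of_nonneg ha, Real.norm_of_nonneg hb]
        _ ≤ a * 1 + b * 1 := by gcongr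
        _ = 1 := by linarith
    · have h3 := (convex_Ioi (1 - β)) hy2 hy2' ha hb hab
      simpa using h3
    · have : a • w + b • w' - T x0 (a • y + b • y') = a • (w - T x0 y) + b • (w' - T x0 y') := by
        rw [map_add, map_smul, map_smul]; module
      rw [this]
      calc _ ≤ ‖a • (w - T x0 y)‖ + ‖b • (w' - T x0 y')‖ := norm_add_le _ _
        _ = a * ‖w - T x0 y‖ + b * ‖w' - T x0 y'‖ := by
          rw [norm_smul, norm_smul, Real.norm_of_nonneg ha, Real.norm_of_nonneg hb]
        _ ≤ a * (e + 2 / δ * (1 - φ w)) + b * (e + 2 / δ * (1 - φ w')) := by gcongr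
        _ = (a + b) * (e + 2 / δ) - 2 / δ * (a * φ w + b * φ w') := by ring
        _ = _ := by rw [hab, map_add, map_smul, map_smul, smul_eq_mul, smul_eq_mul]; ring
  have hsub : {w | ∃ x y, ‖x‖ ≤ 1 ∧ ‖y‖ ≤ 1 ∧ w = T x y} ⊆ D := by
    have main : ∀ x y, ‖x‖ ≤ 1 → ‖y‖ ≤ 1 → 1 - δ < f x → 1 - δ < g y → T x y ∈ D := by
      intro x y hx hy hfx hgy
      refine ⟨y, ⟨hy, by linarith⟩, ?_⟩
      have h1 := hd x hx (by linarith)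
      have h2 : T x y - T x0 y = T (x - x0) y := by simp
      rw [h2, hφ]
      have h3 : f x * g y ≤ 1 := by
        have hx1 := abs_le.1 (apply_le_one_of f hf x hx)
        have hy1 := abs_le.1 (apply_le_one_of g hg y hy)
        nlinarith
      have h4 : 0 ≤ 2 / δ * (1 - f x * g y) := mul_nonneg (by positivity) (by linarith)
      have h5 := hT (x - x0) y
      nlinarith [norm_nonneg (x - x0), norm_nonneg y]
    rintro w ⟨x, y, hx, hy, rfl⟩
    by_cases h : 1 - δ < f x * g y
    · rcases sign_fix _ _ δ (apply_le_one_of f hf x hx) (apply_le_one_of g hg y hy) hδ1 h with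
        ⟨h1, h2⟩ | ⟨h1, h2⟩
      · exact main x y hx hy h1 h2
      · have := main (-x) (-y) (by rwa [norm_neg]) (by rwa [norm_neg]) (by rwa [map_neg])
          (by rwa [map_neg])
        simpa using this
    · obtain ⟨y1, hy1, hy2⟩ := exists_slice_point g hg β hβ
      refine ⟨y1, ⟨hy1, hy2⟩, ?_⟩
      rw [hφ]
      have h1 : 2 ≤ 2 / δ * (1 - f x * g y) := by
        rw [div_mul_eq_mul_div, le_div_iff₀ hδ]; linarith
      have h2 : ‖T x y - T x0 y1‖ ≤ ‖T x y‖ + ‖T x0 y1‖ := norm_sub_le _ _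
      have h3 := hT x y
      have h4 := hT x0 y1
      have h5 : ‖x‖ * ‖y‖ ≤ 1 := mul_le_one₀ hx (norm_nonneg _) hy
      have h6 : ‖x0‖ * ‖y1‖ ≤ 1 := mul_le_one₀ hx0 (norm_nonneg _) hy1
      linarith
  have hcl : z ∈ closure D := closure_mono (convexHull_min hsub hconv) (hball z hz)
  have hopen : IsOpen {w : P | 1 - δ * e / 2 < φ w ∧ dist w z < e} :=
    (isOpen_lt continuous_const φ.continuous).inter
      (isOpen_lt (continuous_id.dist continuous_const) continuous_const)
  obtain ⟨w, ⟨hw1, hw2⟩, y, hy, hw3⟩ :=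
    mem_closure_iff.1 hcl _ hopen ⟨hφz, by rw [dist_self]; exact he⟩
  refine ⟨y, hy, ?_⟩
  have h1 : 2 / δ * (1 - φ w) ≤ e := by
    rw [div_mul_eq_mul_div, div_le_iff₀ hδ]; linarith
  have h2 : ‖z - T x0 y‖ ≤ ‖z - w‖ + ‖w - T x0 y‖ := norm_sub_le_norm_sub_add_norm_sub _ _ _
  rw [dist_comm, dist_eq_norm] at hw2
  linarith

theorem generic_bscsp {X Y P : Type*} [NormedAddCommGroup X] [NormedSpace ℝ X]
    [NormedAddCommGroup Y] [NormedSpace ℝ Y] [NormedAddCommGroup P] [NormedSpace ℝ P]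
    (T : X →ₗ[ℝ] Y →ₗ[ℝ] P) (hT : ∀ x y, ‖T x y‖ ≤ ‖x‖ * ‖y‖)
    (hball : ∀ z : P, ‖z‖ ≤ 1 →
      z ∈ closure (convexHull ℝ {w | ∃ x y, ‖x‖ ≤ 1 ∧ ‖y‖ ≤ 1 ∧ w = T x y}))
    (hΦ : ∀ (f : StrongDual ℝ X) (g : StrongDual ℝ Y), ∃ φ : StrongDual ℝ P,
      ‖φ‖ ≤ ‖f‖ * ‖g‖ ∧ ∀ x y, φ (T x y) = f x * g y)
    (hX : BallDentableProperty X) (hY : BallSCSProperty Y) : BallSCSProperty P := by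
  intro ε hε
  obtain ⟨e, he, hee⟩ : ∃ e : ℝ, 0 < e ∧ 8 * e ≤ ε := ⟨ε / 8, by positivity, by linarith⟩
  obtain ⟨f, α, hf, hα, hα1, hfd⟩ := hX e he
  obtain ⟨n, lam, g, β, hlam, hsum, hg, hβ, hgd⟩ := hY e he
  obtain ⟨x0, hx0, hx0f⟩ := exists_slice_point f hf α hα
  have hd : ∀ x, ‖x‖ ≤ 1 → 1 - α < f x → ‖x - x0‖ ≤ e := by
    intro x hx hfx
    rw [← dist_eq_norm]
    refine (Metric.dist_le_diam_of_mem ?_ ?_ ?_).trans hfd.le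
    · exact (Metric.isBounded_closedBall (x := (0 : X)) (r := 1)).subset
        (fun z hz => by simpa using hz.1)
    · exact ⟨hx, hfx⟩
    · exact ⟨hx0, hx0f⟩
  choose φ hφn hφ using fun i => hΦ f (g i)
  have hφ1 : ∀ i, ‖φ i‖ = 1 := by
    intro i
    apply le_antisymm
    · have := hφn i
      rwa [hf, hg, one_mul] at this
    · have h1 : ∀ x y, ‖f x‖ * ‖g i y‖ ≤ ‖φ i‖ * ‖x‖ * ‖y‖ := by
        intro x y
        rw [← norm_mul, ← hφ i, mul_assoc]
        exact ((φ i).le_opNorm _).trans (by gcongr; exact hT x y)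
      have h2 : ∀ x, ‖f x‖ ≤ ‖φ i‖ * ‖x‖ := by
        intro x
        have h3 : ‖(‖f x‖ • g i : StrongDual ℝ Y)‖ ≤ ‖φ i‖ * ‖x‖ := by
          refine ContinuousLinearMap.opNorm_le_bound _ (by positivity) (fun y => ?_)
          simpa [norm_mul] using h1 x y
        rw [norm_smul, hg, norm_norm, mul_one] at h3
        exact h3
      rw [← hf]
      exact ContinuousLinearMap.opNorm_le_bound _ (norm_nonneg _) h2
  set δ : Fin (n + 1) → ℝ := fun i => min α (β i) with hδ
  have hδ0 : ∀ i, 0 < δ i := fun i => lt_min hα (hβ i).1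
  have hBdd : Bornology.IsBounded {z : Y | ∃ u : Fin (n + 1) → Y,
      (∀ i, ‖u i‖ ≤ 1 ∧ 1 - β i < g i (u i)) ∧ z = ∑ i, lam i • u i} := by
    refine (Metric.isBounded_closedBall (x := (0 : Y)) (r := 1)).subset ?_
    rintro z ⟨u, hu, rfl⟩
    rw [mem_closedBall_zero_iff]
    calc ‖∑ i, lam i • u i‖ ≤ ∑ i, ‖lam i • u i‖ := norm_sum_le _ _
      _ ≤ ∑ i, lam i := by
        refine Finset.sum_le_sum fun i _ => ?_
        rw [norm_smul, Real.norm_of_nonneg (hlam i).le]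
        nlinarith [(hu i).1, hlam i]
      _ = 1 := hsum
  refine ⟨n, lam, φ, fun i => min (1 / 2) (δ i * e / 2), hlam, hsum, hφ1, ?_, ?_⟩
  · intro i
    have := hδ0 i
    exact ⟨lt_min (by norm_num) (by positivity), (min_le_left _ _).trans_lt (by norm_num)⟩
  refine lt_of_le_of_lt (Metric.diam_le_of_forall_dist_le (C := 7 * e) (by positivity) ?_)
    (by linarith)
  have happ : ∀ u : Fin (n + 1) → P,
      (∀ i, ‖u i‖ ≤ 1 ∧ 1 - min (1 / 2) (δ i * e / 2) < φ i (u i)) →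
      ∃ y : Fin (n + 1) → Y, (∀ i, ‖y i‖ ≤ 1 ∧ 1 - β i < g i (y i)) ∧
        ‖∑ i, lam i • u i - T x0 (∑ i, lam i • y i)‖ ≤ 3 * e := by
    intro u hu
    have : ∀ i, ∃ y, (‖y‖ ≤ 1 ∧ 1 - β i < g i y) ∧ ‖u i - T x0 y‖ ≤ 3 * e := by
      intro i
      refine key_approx T hT hball f (g i) hf (hg i) (φ i) (hφ i) α (β i) (δ i) e (hβ i).1
        (hδ0 i) ((min_le_left _ _).trans hα1.le) (min_le_left _ _) (min_le_right _ _) he x0 hx0 hd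
        (u i) (hu i).1 ?_
      have h1 := (hu i).2
      have h2 := min_le_right (1 / 2) (δ i * e / 2)
      linarith
    choose y hy hyu using this
    refine ⟨y, hy, ?_⟩
    have h1 : ∑ i, lam i • u i - T x0 (∑ i, lam i • y i) = ∑ i, lam i • (u i - T x0 (y i)) := by
      simp only [map_sum, map_smul, smul_sub, Finset.sum_sub_distrib]
    rw [h1]
    calc _ ≤ ∑ i, ‖lam i • (u i - T x0 (y i))‖ := norm_sum_le _ _
      _ ≤ ∑ i, lam i * (3 * e) := by
        refine Finset.sum_le_sum fun i _ => ?_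
        rw [norm_smul, Real.norm_of_nonneg (hlam i).le]
        exact mul_le_mul_of_nonneg_left (hyu i) (hlam i).le
      _ = 3 * e := by rw [← Finset.sum_mul, hsum, one_mul]
  rintro z ⟨u, hu, rfl⟩ z' ⟨u', hu', rfl⟩
  obtain ⟨y, hy, h1⟩ := happ u hu
  obtain ⟨y', hy', h2⟩ := happ u' hu'
  have h3 : dist (∑ i, lam i • y i) (∑ i, lam i • y' i) ≤ e :=
    (Metric.dist_le_diam_of_mem hBdd ⟨y, hy, rfl⟩ ⟨y', hy', rfl⟩).trans hgd.le
  rw [dist_eq_norm] at h3 ⊢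
  set s := ∑ i, lam i • y i
  set s' := ∑ i, lam i • y' i
  set a := ∑ i, lam i • u i
  set a' := ∑ i, lam i • u' i
  have h4 : a - a' = (a - T x0 s) - (a' - T x0 s') + T x0 (s - s') := by
    rw [map_sub]; abel
  have h5 := hT x0 (s - s')
  have h6 : ‖x0‖ * ‖s - s'‖ ≤ 1 * e := by gcongr
  rw [h4]
  have h7 := norm_add_le ((a - T x0 s) - (a' - T x0 s')) (T x0 (s - s'))
  have h8 := norm_sub_le (a - T x0 s) (a' - T x0 s')
  linarith

section Concrete

variable {X Y : Type*} [NormedAddCommGroup X] [NormedSpace ℝ X]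
  [NormedAddCommGroup Y] [NormedSpace ℝ Y]

theorem bbf_le (b : BoundedBilinearForms X Y) (x : X) (y : Y) :
    ‖projTensorElem x y b‖ ≤ ‖b‖ * ‖x‖ * ‖y‖ :=
  ContinuousLinearMap.le_opNorm₂ (E := X) (F := Y) (G := ℝ) b x y

theorem projTensorElem_norm_le (x : X) (y : Y) :
    ‖projTensorElem x y‖ ≤ ‖x‖ * ‖y‖ := by
  refine ContinuousLinearMap.opNorm_le_bound _ (by positivity) (fun b => ?_)
  have := bbf_le b x y
  nlinarith

/-- The bilinear map of elementary tensors. -/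
noncomputable def tensV : X →ₗ[ℝ] Y →ₗ[ℝ] StrongDual ℝ (BoundedBilinearForms X Y) :=
  LinearMap.mk₂ ℝ projTensorElem
    (fun x x' y => by
      ext b
      exact congrArg (fun l : Y →L[ℝ] ℝ => l y)
        (ContinuousLinearMap.map_add (show X →L[ℝ] Y →L[ℝ] ℝ from b) x x'))
    (fun c x y => by
      ext b
      exact congrArg (fun l : Y →L[ℝ] ℝ => l y)
        (ContinuousLinearMap.map_smul (show X →L[ℝ] Y →L[ℝ] ℝ from b) c x))
    (fun x y y' => by
      ext b
      exact ContinuousLinearMap.map_add ((show X →L[ℝ] Y →L[ℝ] ℝ from b) x) y y')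
    (fun c x y => by
      ext b
      exact ContinuousLinearMap.map_smul ((show X →L[ℝ] Y →L[ℝ] ℝ from b) x) c y)

/-- Make a bounded bilinear form. -/
theorem exists_bbf (B : X →ₗ[ℝ] Y →ₗ[ℝ] ℝ) (C : ℝ) (hC : 0 ≤ C)
    (h : ∀ x y, ‖B x y‖ ≤ C * ‖x‖ * ‖y‖) :
    ∃ b : BoundedBilinearForms X Y, ‖b‖ ≤ C ∧ ∀ x y, projTensorElem x y b = B x y :=
  ⟨(LinearMap.mkContinuous₂ B C h : X →L[ℝ] Y →L[ℝ] ℝ),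
    LinearMap.mkContinuous₂_norm_le B hC h, fun _ _ => rfl⟩

theorem ball_subset (z : StrongDual ℝ (BoundedBilinearForms X Y))
    (hz : z ∈ ProjectiveTensorProduct X Y) (hz1 : ‖z‖ ≤ 1) :
    z ∈ closure (convexHull ℝ
      {w | ∃ (x : X) (y : Y), ‖x‖ ≤ 1 ∧ ‖y‖ ≤ 1 ∧ w = projTensorElem x y}) := by
  by_contra hcon
  obtain ⟨F, s, hF, hs⟩ := geometric_hahn_banach_closed_point
    ((convex_convexHull ℝ _).closure) isClosed_closure hcon
  have hF' : ∀ (x : X) (y : Y), ‖x‖ ≤ 1 → ‖y‖ ≤ 1 → F (tensV x y) < s := fun x y hx hy =>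
    hF _ (subset_closure (subset_convexHull ℝ _ ⟨x, y, hx, hy, rfl⟩))
  have hs0 : 0 < s := by simpa using hF' 0 0 (by simp) (by simp)
  have hbd : ∀ (x : X) (y : Y), ‖F (tensV x y)‖ ≤ s * ‖x‖ * ‖y‖ := by
    intro x y
    by_cases hx : x = 0
    · simp [hx]
    by_cases hy : y = 0
    · simp [hy]
    have hx' := norm_pos_iff.2 hx
    have hy' := norm_pos_iff.2 hy
    have n1 : ‖(‖x‖⁻¹ • x)‖ ≤ 1 := by rw [norm_smul, norm_inv, norm_norm, inv_mul_cancel₀ hx'.ne']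
    have n2 : ‖(‖y‖⁻¹ • y)‖ ≤ 1 := by rw [norm_smul, norm_inv, norm_norm, inv_mul_cancel₀ hy'.ne']
    have k1 := hF' _ _ n1 n2
    have k2 := hF' (-(‖x‖⁻¹ • x)) _ (by rwa [norm_neg]) n2
    simp only [map_neg, map_smul, LinearMap.neg_apply, LinearMap.smul_apply, smul_eq_mul] at k1 k2
    have e1 : F (tensV x y) = ‖x‖ * ‖y‖ * (‖x‖⁻¹ * (‖y‖⁻¹ * F (tensV x y))) := by
      field_simp
    have hp : 0 < ‖x‖ * ‖y‖ := by positivity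
    rw [Real.norm_eq_abs, abs_le]
    constructor
    · nlinarith
    · nlinarith
  obtain ⟨b, hb, hbe⟩ := exists_bbf
    ((tensV (X := X) (Y := Y)).compr₂ F.toLinearMap) s hs0.le hbd
  have hker : ProjectiveTensorProduct X Y ≤
      LinearMap.ker (F - ContinuousLinearMap.apply ℝ ℝ b :
        StrongDual ℝ (BoundedBilinearForms X Y) →L[ℝ] ℝ).toLinearMap := by
    refine Submodule.topologicalClosure_minimal _ (Submodule.span_le.2 ?_)
      (ContinuousLinearMap.isClosed_ker _)
    rintro _ ⟨x, y, rfl⟩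
    have h1 : projTensorElem x y b = F (projTensorElem x y) := hbe x y
    simp [h1]
  have h2 := hker hz
  have h3 : F z = z b := by
    have : F z - z b = 0 := h2
    linarith
  have h4 := z.le_opNorm b
  have h5 : ‖z‖ * ‖b‖ ≤ 1 * s := by gcongr
  have h6 := le_abs_self (z b)
  rw [Real.norm_eq_abs] at h4
  linarith

theorem projTensorElem_mem (x : X) (y : Y) :
    projTensorElem x y ∈ ProjectiveTensorProduct X Y :=
  subset_closure (Submodule.subset_span ⟨x, y, rfl⟩)

/-- The bilinear map of elementary tensors into the projective tensor product. -/
noncomputable def tensP : X →ₗ[ℝ] Y →ₗ[ℝ] ↥(ProjectiveTensorProduct X Y) :=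
  LinearMap.mk₂ ℝ (fun x y => ⟨projTensorElem x y, projTensorElem_mem x y⟩)
    (fun x x' y => Subtype.ext (tensV.map_add₂ x x' y))
    (fun c x y => Subtype.ext (tensV.map_smul₂ c x y))
    (fun x y y' => Subtype.ext ((tensV x).map_add y y'))
    (fun c x y => Subtype.ext ((tensV x).map_smul c y))

theorem concrete_bscsp (hX : BallDentableProperty X) (hY : BallSCSProperty Y) :
    BallSCSProperty ↥(ProjectiveTensorProduct X Y) := by
  refine generic_bscsp tensP (fun x y => projTensorElem_norm_le x y) ?_ ?_ hX hY
  · intro z hz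
    rw [Topology.IsInducing.subtypeVal.closure_eq_preimage_closure_image]
    have h1 : (Subtype.val : ↥(ProjectiveTensorProduct X Y) → _) ''
        (convexHull ℝ {w | ∃ (x : X) (y : Y), ‖x‖ ≤ 1 ∧ ‖y‖ ≤ 1 ∧ w = tensP x y}) =
        convexHull ℝ {w | ∃ (x : X) (y : Y), ‖x‖ ≤ 1 ∧ ‖y‖ ≤ 1 ∧ w = projTensorElem x y} := by
      have h2 := (ProjectiveTensorProduct X Y).subtype.image_convexHull
        {w | ∃ (x : X) (y : Y), ‖x‖ ≤ 1 ∧ ‖y‖ ≤ 1 ∧ w = tensP x y}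
      refine h2.trans (congrArg _ ?_)
      ext w
      constructor
      · rintro ⟨_, ⟨x, y, hx, hy, rfl⟩, rfl⟩
        exact ⟨x, y, hx, hy, rfl⟩
      · rintro ⟨x, y, hx, hy, rfl⟩
        exact ⟨_, ⟨x, y, hx, hy, rfl⟩, rfl⟩
    have h3 := ball_subset z.1 z.2 hz
    rw [← h1] at h3
    exact h3
  · intro f g
    obtain ⟨b, hb, hbe⟩ := exists_bbf
      (LinearMap.mk₂ ℝ (fun (x : X) (y : Y) => f x * g y)
        (fun x x' y => by simp [add_mul]) (fun c x y => by simp [mul_assoc])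
        (fun x y y' => by simp [mul_add]) (fun c x y => by simp [mul_left_comm]))
      (‖f‖ * ‖g‖) (by positivity) (fun x y => by
        have h1 := f.le_opNorm x
        have h2 := g.le_opNorm y
        rw [LinearMap.mk₂_apply, norm_mul]
        calc _ ≤ (‖f‖ * ‖x‖) * (‖g‖ * ‖y‖) := by gcongr
          _ = _ := by ring)
    refine ⟨(ContinuousLinearMap.apply ℝ ℝ b).comp (ProjectiveTensorProduct X Y).subtypeL,
      ?_, fun x y => hbe x y⟩
    refine ContinuousLinearMap.opNorm_le_bound _ (by positivity) (fun z => ?_)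
    have h1 := z.1.le_opNorm b
    calc _ ≤ ‖z.1‖ * ‖b‖ := h1
      _ ≤ ‖z.1‖ * (‖f‖ * ‖g‖) := by gcongr
      _ = _ := mul_comm _ _

end Concrete

/-- Corollary 2.13: if `X` has the BDP and `Y` has the BSCSP, then the projective
tensor product `X ⊗̂_π Y` has the BSCSP. -/
theorem statement9 {X Y : Type*} [NormedAddCommGroup X] [NormedSpace ℝ X] [CompleteSpace X]
    [NormedAddCommGroup Y] [NormedSpace ℝ Y] [CompleteSpace Y]
    (hX : BallDentableProperty X) (hY : BallSCSProperty Y) :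
    BallSCSProperty (ProjectiveTensorSpace X Y) :=
  concrete_bscsp hX hY
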